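/- Let k ≥ 3 and let j ∈ (ℤ∖{0})^k be ordered so that |j_1| ≤ … ≤ |j_k|; set μ(j,l) and S(j,l) as the third largest modulus and (largest − second largest + third largest) modulus among {|j_1|,…,|j_k|,|l|}, for l ∈ ℤ∖{0}. Then for every l, one has |l| · μ(j,l)/S(j,l) ≤ 2 |j_k|. -/

import Mathlib

/-- The list sorted in decreasing order. -/
def sortD (m : List ℕ) : List ℕ := m.insertionSort (· ≥ ·)

/-- `μ`: the third largest entry of a multi-index (by modulus), `1` for short lists. -/
def mu3 (m : List ℕ) : ℕ := (sortD m).getD 2 1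

/-- `S`: (largest) − (second largest) + (third largest). -/
def SS (m : List ℕ) : ℕ := ((sortD m).getD 0 1 - (sortD m).getD 1 1) + mu3 m

theorem sortD_append_max (t : List ℕ) (L : ℕ) (h : ∀ x ∈ t, x ≤ L) :
    sortD (t ++ [L]) = L :: sortD t := by
  have hp : (sortD (t ++ [L])).Perm (L :: sortD t) := by
    refine (List.perm_insertionSort _ _).trans ?_
    refine List.perm_append_comm.trans ?_
    exact (List.Perm.cons L (List.perm_insertionSort (· ≥ ·) t).symm)
  have h1 : (sortD (t ++ [L])).Pairwise (· ≥ ·) := List.pairwise_insertionSort _ _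
  have h2 : (L :: sortD t).Pairwise (· ≥ ·) := by
    refine List.pairwise_cons.2 ⟨?_, List.pairwise_insertionSort _ _⟩
    intro x hx
    exact h x ((List.perm_insertionSort (· ≥ ·) t).mem_iff.1 hx)
  exact hp.eq_of_pairwise (fun a b _ _ hab hba => le_antisymm hba hab) h1 h2

theorem key_bound (t : List ℕ) (ht : 2 ≤ t.length) (L J : ℕ) (h : ∀ x ∈ t, x ≤ J) :
    L * mu3 (t ++ [L]) ≤ 2 * J * SS (t ++ [L]) := by
  by_cases hL : L ≤ 2 * J
  · exact Nat.mul_le_mul hL (by unfold SS; omega)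
  · have e := sortD_append_max t L (fun x hx => (h x hx).trans (by omega))
    have hlen : (sortD t).length = t.length := List.length_insertionSort _ _
    have hm : ∀ x ∈ sortD t, x ≤ J := fun x hx =>
      h x ((List.perm_insertionSort (· ≥ ·) t).mem_iff.1 hx)
    unfold SS mu3
    rw [e]
    match hs : sortD t with
    | [] => simp [hs] at hlen; omega
    | [a] => simp [hs] at hlen; omega
    | a :: b :: r =>
      have ha : a ≤ J := hm a (by simp [hs])
      have hb : b ≤ J := hm b (by simp [hs])
      simp only [List.getD_cons_zero, List.getD_cons_succ]
      have : L ≤ 2 * (L - a + b) := by omega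
      calc L * b ≤ (2 * (L - a + b)) * J := Nat.mul_le_mul this hb
        _ = _ := by ring

/-- For `k ≥ 3`, `j ∈ (ℤ∖{0})^k` ordered by increasing modulus and any `l ∈ ℤ∖{0}`,
one has `|l| · μ(j,l)/S(j,l) ≤ 2 |j_k|`. -/
theorem stmt_6 (k : ℕ) (hk : 3 ≤ k) (j : Fin k → ℤ)
    (hne : ∀ i, j i ≠ 0)
    (hord : ∀ i i' : Fin k, i ≤ i' → |j i| ≤ |j i'|)
    (l : ℤ) (hl : l ≠ 0) :
    (l.natAbs : ℝ) * (mu3 ((List.ofFn fun i => (j i).natAbs) ++ [l.natAbs]) : ℝ) /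
        (SS ((List.ofFn fun i => (j i).natAbs) ++ [l.natAbs]) : ℝ) ≤
      2 * ((j ⟨k - 1, by omega⟩).natAbs : ℝ) := by
  have hb := key_bound (List.ofFn fun i => (j i).natAbs) (by simp; omega) l.natAbs
    (j ⟨k - 1, by omega⟩).natAbs (by
      intro x hx
      obtain ⟨i, rfl⟩ := (List.mem_ofFn' _ _).1 hx
      have h1 := hord i ⟨k - 1, by omega⟩ (by
        rw [Fin.le_def]
        have := i.2
        simp only
        omega)
      simp only [Int.abs_eq_natAbs] at h1 ⊢
      omega)
  refine div_le_of_le_mul₀ (by positivity) (by positivity) ?_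
  exact_mod_cast hb
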